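/- There exist no real number p ≥ 2 and no continuous nondecreasing function κ : [0,∞) → [0,∞) with κ(0) = 0 such that |a(y₁) − a(y₂)|^p ≤ κ(|y₁ − y₂|^p) for all y₁, y₂ ∈ ℝ. -/

import Mathlib

/-- The function `a` from Example 3.16 of the paper. For `y ≥ 0` with `n = ⌊y⌋` one has
`a(y) = n` for `n ≤ y ≤ n + 1 − 1/(n+1)` and `a(y) = n + (n+1)(y − (n + 1 − 1/(n+1)))` for
`n + 1 − 1/(n+1) ≤ y ≤ n + 1`; for `y < 0` one sets `a(y) := a(−y)`. Equivalently, for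
`y ≥ 0` with `n = ⌊y⌋`: `a(y) = n + max 0 ((n+1)(y − n) − n)`. -/
noncomputable def aFun (y : ℝ) : ℝ :=
  (⌊|y|⌋ : ℝ) + max 0 (((⌊|y|⌋ : ℝ) + 1) * (|y| - (⌊|y|⌋ : ℝ)) - (⌊|y|⌋ : ℝ))

theorem aFun_natCast (n : ℕ) : aFun n = n := by
  simp [aFun]

theorem aFun_natCast_add_one_sub (n : ℕ) : aFun ((n : ℝ) + 1 - 1 / ((n : ℝ) + 1)) = n := by
  have hpos : (0 : ℝ) < (n : ℝ) + 1 := by positivity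
  have hinv : 0 < 1 / ((n : ℝ) + 1) := by positivity
  have hle : 1 / ((n : ℝ) + 1) ≤ 1 := by
    rw [div_le_one hpos]
    linarith [(Nat.cast_nonneg n : (0 : ℝ) ≤ n)]
  have habs : |(n : ℝ) + 1 - 1 / ((n : ℝ) + 1)| = (n : ℝ) + 1 - 1 / ((n : ℝ) + 1) :=
    abs_of_nonneg (by linarith [(Nat.cast_nonneg n : (0 : ℝ) ≤ n)])
  have hfloor : ⌊(n : ℝ) + 1 - 1 / ((n : ℝ) + 1)⌋ = (n : ℤ) := by
    rw [Int.floor_eq_iff]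
    constructor <;> push_cast <;> linarith
  have hzero :
      ((n : ℝ) + 1) * ((n : ℝ) + 1 - 1 / ((n : ℝ) + 1) - n) - n = 0 := by
    field_simp
    ring
  unfold aFun
  rw [habs, hfloor, Int.cast_natCast, hzero, max_self, add_zero]

/-- Example 3.16 of the paper: there exist no real `p ≥ 2` and no continuous
nondecreasing function `κ : [0,∞) → [0,∞)` with `κ(0) = 0` such that
`|a(y₁) − a(y₂)|^p ≤ κ(|y₁ − y₂|^p)` for all `y₁, y₂ ∈ ℝ`. -/
theorem no_kappa_for_aFun :
    ¬ ∃ (p : ℝ) (κ : ℝ → ℝ), 2 ≤ p ∧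
      ContinuousOn κ (Set.Ici 0) ∧
      MonotoneOn κ (Set.Ici 0) ∧
      (∀ u : ℝ, 0 ≤ u → 0 ≤ κ u) ∧
      κ 0 = 0 ∧
      ∀ y₁ y₂ : ℝ, |aFun y₁ - aFun y₂| ^ p ≤ κ (|y₁ - y₂| ^ p) := by
  rintro ⟨p, κ, hp, hcont, -, -, hκ0, h⟩
  have hp0 : 0 < p := by linarith
  have hlim : Filter.Tendsto (fun n : ℕ => (1 / ((n : ℝ) + 1)) ^ p) Filter.atTop
      (nhdsWithin 0 (Set.Ici 0)) := by
    refine tendsto_nhdsWithin_iff.2 ⟨?_, Filter.Eventually.of_forall fun n => ?_⟩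
    · simpa [Real.zero_rpow hp0.ne'] using
        (tendsto_one_div_add_atTop_nhds_zero_nat (𝕜 := ℝ)).rpow_const (p := p) (Or.inr hp0.le)
    · exact Real.rpow_nonneg (by positivity) p
  have hκlim := (hcont 0 Set.self_mem_Ici).tendsto.comp hlim
  rw [hκ0] at hκlim
  have hone : (1 : ℝ) ≤ 0 := by
    refine ge_of_tendsto' hκlim fun n => ?_
    have hn := h ((n + 1 : ℕ) : ℝ) ((n : ℝ) + 1 - 1 / ((n : ℝ) + 1))
    rw [aFun_natCast, aFun_natCast_add_one_sub, Nat.cast_add_one, add_sub_cancel_left,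
      sub_sub_cancel, abs_one, Real.one_rpow, abs_of_pos (by positivity)] at hn
    exact hn
  linarith
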